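/- There exist constants r > 0, κ ≥ 1 and θ > 0 such that every classical solution ζ of the μ-system whose initial state satisfies ‖(ζ₀,z₀)‖_H ≤ r obeys the exponential decay estimate E(t) ≤ κ E(0) e^{−2θ t} for all t > 0. -/

import Mathlib

open MeasureTheory intervalIntegral Set

noncomputable section

/-- Partial derivative in time. -/
def pT (ζ : ℝ → ℝ → ℝ → ℝ) (x y t : ℝ) : ℝ := deriv (fun τ => ζ x y τ) t
/-- Partial derivative in `x`. -/
def pX (ζ : ℝ → ℝ → ℝ → ℝ) (x y t : ℝ) : ℝ := deriv (fun s => ζ s y t) x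
/-- Third partial derivative in `x`. -/
def pX3 (ζ : ℝ → ℝ → ℝ → ℝ) (x y t : ℝ) : ℝ := iteratedDeriv 3 (fun s => ζ s y t) x
/-- Partial derivative in `y`. -/
def pY (ζ : ℝ → ℝ → ℝ → ℝ) (x y t : ℝ) : ℝ := deriv (fun r => ζ x r t) y
/-- Mixed derivative `∂ₓ∂ᵧ²`. -/
def pXYY (ζ : ℝ → ℝ → ℝ → ℝ) (x y t : ℝ) : ℝ :=
  deriv (fun s => iteratedDeriv 2 (fun r => ζ s r t) y) x

/-- Smoothness of a function of three real variables. -/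
def Smooth3 (ζ : ℝ → ℝ → ℝ → ℝ) : Prop :=
  ContDiff ℝ (⊤ : ℕ∞) (fun p : ℝ × ℝ × ℝ => ζ p.1 p.2.1 p.2.2)

/-- Boundary conditions of the ZK-type systems on `Ω = (0,L)×(0,L)`. -/
def ZKbc (L : ℝ) (ζ : ℝ → ℝ → ℝ → ℝ) : Prop :=
  ∀ t > (0:ℝ),
    (∀ y ∈ Ioo (0:ℝ) L,
      ζ 0 y t = 0 ∧ ζ L y t = 0 ∧ pX ζ L y t = 0 ∧ pY ζ L y t = 0) ∧
    (∀ x ∈ Ioo (0:ℝ) L, ζ x 0 t = 0 ∧ ζ x L t = 0)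

/-- `M` is the essential supremum of `f` on `Ω = (0,L)×(0,L)`:
the greatest lower bound of the set of a.e. upper bounds. -/
def IsEssSupOn (L : ℝ) (f : ℝ → ℝ → ℝ) (M : ℝ) : Prop :=
  IsGLB {c : ℝ | ∀ᵐ p ∂(volume.restrict (Ioo (0:ℝ) L ×ˢ Ioo (0:ℝ) L)),
    f p.1 p.2 ≤ c} M

/-- Bounded, nonnegative, measurable coefficient. -/
def Coeff (f : ℝ → ℝ → ℝ) : Prop :=
  Measurable (fun p : ℝ × ℝ => f p.1 p.2) ∧ (∀ x y, 0 ≤ f x y) ∧ ∃ M, ∀ x y, f x y ≤ M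

/-- Squared `H`-norm of an initial state, with weight `w` on the delay component. -/
def Hn2 (L w : ℝ) (f : ℝ → ℝ → ℝ) (g : ℝ → ℝ → ℝ → ℝ) : ℝ :=
  (∫ x in (0:ℝ)..L, ∫ y in (0:ℝ)..L, (f x y)^2)
  + w * (∫ x in (0:ℝ)..L, ∫ y in (0:ℝ)..L, ∫ ρ in (0:ℝ)..1, (g x y ρ)^2)

/-- `L²(Ω)` norm of `w(·,·,t)`. -/
def L2n (L : ℝ) (w : ℝ → ℝ → ℝ → ℝ) (t : ℝ) : ℝ :=
  Real.sqrt (∫ x in (0:ℝ)..L, ∫ y in (0:ℝ)..L, (w x y t)^2)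

/-- Squared `H¹(Ω)` norm of `w(·,·,t)`. -/
def H1n2 (L : ℝ) (w : ℝ → ℝ → ℝ → ℝ) (t : ℝ) : ℝ :=
  ∫ x in (0:ℝ)..L, ∫ y in (0:ℝ)..L,
    ((w x y t)^2 + (pX w x y t)^2 + (pY w x y t)^2)

/-- Classical solution of the delayed ZK system. -/
def IsZKSol (L α γ h : ℝ) (a b : ℝ → ℝ → ℝ) (ζ : ℝ → ℝ → ℝ → ℝ) : Prop :=
  Smooth3 ζ ∧ ZKbc L ζ ∧
  ∀ x ∈ Ioo (0:ℝ) L, ∀ y ∈ Ioo (0:ℝ) L, ∀ t > (0:ℝ),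
    pT ζ x y t + α * pX3 ζ x y t + γ * pXYY ζ x y t + ζ x y t * pX ζ x y t
      + a x y * ζ x y t + b x y * ζ x y (t - h) = 0

/-- Energy of the delayed ZK system. -/
def zkE (L h : ℝ) (b : ℝ → ℝ → ℝ) (ζ : ℝ → ℝ → ℝ → ℝ) (t : ℝ) : ℝ :=
  (1/2) * (∫ x in (0:ℝ)..L, ∫ y in (0:ℝ)..L, (ζ x y t)^2)
  + (h/2) * (∫ x in (0:ℝ)..L, ∫ y in (0:ℝ)..L, ∫ ρ in (0:ℝ)..1,
      b x y * (ζ x y (t - ρ*h))^2)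

/-- Classical solution of the (nonlinear) μ-system. -/
def IsMuSol (L α γ h μ₁ μ₂ : ℝ) (a : ℝ → ℝ → ℝ) (ζ : ℝ → ℝ → ℝ → ℝ) : Prop :=
  Smooth3 ζ ∧ ZKbc L ζ ∧
  ∀ x ∈ Ioo (0:ℝ) L, ∀ y ∈ Ioo (0:ℝ) L, ∀ t > (0:ℝ),
    pT ζ x y t + α * pX3 ζ x y t + γ * pXYY ζ x y t + ζ x y t * pX ζ x y t
      + a x y * (μ₁ * ζ x y t + μ₂ * ζ x y (t - h)) = 0

/-- Classical solution of the linear μ-system with source `f`. -/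
def IsLinMuSolF (L α γ h μ₁ μ₂ : ℝ) (a : ℝ → ℝ → ℝ) (f : ℝ → ℝ → ℝ → ℝ)
    (ζ : ℝ → ℝ → ℝ → ℝ) : Prop :=
  Smooth3 ζ ∧ ZKbc L ζ ∧
  ∀ x ∈ Ioo (0:ℝ) L, ∀ y ∈ Ioo (0:ℝ) L, ∀ t > (0:ℝ),
    pT ζ x y t + α * pX3 ζ x y t + γ * pXYY ζ x y t
      + a x y * (μ₁ * ζ x y t + μ₂ * ζ x y (t - h)) = f x y t

/-- Classical solution of the linear μ-system. -/
def IsLinMuSol (L α γ h μ₁ μ₂ : ℝ) (a : ℝ → ℝ → ℝ) (ζ : ℝ → ℝ → ℝ → ℝ) : Prop :=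
  IsLinMuSolF L α γ h μ₁ μ₂ a (fun _ _ _ => 0) ζ

/-- Energy of the μ-system. -/
def muE (L h ξ : ℝ) (a : ℝ → ℝ → ℝ) (ζ : ℝ → ℝ → ℝ → ℝ) (t : ℝ) : ℝ :=
  (1/2) * (∫ x in (0:ℝ)..L, ∫ y in (0:ℝ)..L, (ζ x y t)^2)
  + (ξ/2) * (∫ x in (0:ℝ)..L, ∫ y in (0:ℝ)..L, ∫ ρ in (0:ℝ)..1,
      a x y * (ζ x y (t - ρ*h))^2)

/-- Classical solution of the perturbed delayed ZK system with source `f`. -/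
def IsPertSol (L α γ h ξ : ℝ) (a b : ℝ → ℝ → ℝ) (f : ℝ → ℝ → ℝ → ℝ)
    (ζ : ℝ → ℝ → ℝ → ℝ) : Prop :=
  Smooth3 ζ ∧ ZKbc L ζ ∧
  ∀ x ∈ Ioo (0:ℝ) L, ∀ y ∈ Ioo (0:ℝ) L, ∀ t > (0:ℝ),
    pT ζ x y t + α * pX3 ζ x y t + γ * pXYY ζ x y t
      + a x y * ζ x y t + b x y * (ξ * ζ x y t + ζ x y (t - h)) = f x y t

/-- Energy `E_ξ` of the perturbed delayed ZK system. -/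
def pertE (L h ξ : ℝ) (b : ℝ → ℝ → ℝ) (ζ : ℝ → ℝ → ℝ → ℝ) (t : ℝ) : ℝ :=
  (1/2) * (∫ x in (0:ℝ)..L, ∫ y in (0:ℝ)..L, (ζ x y t)^2)
  + (ξ*h/2) * (∫ x in (0:ℝ)..L, ∫ y in (0:ℝ)..L, ∫ ρ in (0:ℝ)..1,
      b x y * (ζ x y (t - ρ*h))^2)

/-! ### Directional derivatives of smooth functions -/

section DirectionalDerivative

variable {E : Type*} [NormedAddCommGroup E] [NormedSpace ℝ E]

/-- Derivative of `f` in the direction `v`. -/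
def dirDeriv (v : E) (f : E → ℝ) (p : E) : ℝ := fderiv ℝ f p v

lemma contDiff_dirDeriv {f : E → ℝ} (hf : ContDiff ℝ (⊤ : ℕ∞) f) (v : E) :
    ContDiff ℝ (⊤ : ℕ∞) (dirDeriv v f) :=
  (hf.fderiv_right (m := ((⊤ : ℕ∞) : WithTop ℕ∞)) (by simp)).clm_apply contDiff_const

lemma hasDerivAt_dirDeriv {f : E → ℝ} (hf : ContDiff ℝ (⊤ : ℕ∞) f) {c : ℝ → E} {v : E} {s : ℝ}
    (hc : HasDerivAt c v s) : HasDerivAt (fun σ => f (c σ)) (dirDeriv v f (c s)) s :=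
  ((hf.differentiable (by simp)) (c s)).hasFDerivAt.comp_hasDerivAt s hc

lemma dirDeriv_comm {f : E → ℝ} (hf : ContDiff ℝ (⊤ : ℕ∞) f) (v w : E) (p : E) :
    dirDeriv v (dirDeriv w f) p = dirDeriv w (dirDeriv v f) p := by
  have hd : DifferentiableAt ℝ (fderiv ℝ f) p :=
    ((hf.fderiv_right (m := ((⊤ : ℕ∞) : WithTop ℕ∞)) (by simp)).differentiable (by simp)) p
  have key : ∀ a b : E, dirDeriv a (dirDeriv b f) p = fderiv ℝ (fderiv ℝ f) p a b := by
    intro a b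
    change fderiv ℝ (fun q => fderiv ℝ f q b) p a = _
    rw [fderiv_clm_apply hd (differentiableAt_const b)]
    simp
  rw [key, key]
  exact (hf.contDiffAt.isSymmSndFDerivAt (by
    rw [minSmoothness_of_isRCLikeNormedField]; exact WithTop.coe_le_coe.2 (le_top : (2 : ℕ∞) ≤ ⊤))) v w

end DirectionalDerivative

/-- Partial derivative in the first variable of a function on `ℝ × ℝ`. -/
def dX (u : ℝ × ℝ → ℝ) : ℝ × ℝ → ℝ := dirDeriv ((1, 0) : ℝ × ℝ) u

/-- Partial derivative in the second variable of a function on `ℝ × ℝ`. -/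
def dY (u : ℝ × ℝ → ℝ) : ℝ × ℝ → ℝ := dirDeriv ((0, 1) : ℝ × ℝ) u

lemma contDiff_dX {u : ℝ × ℝ → ℝ} (hu : ContDiff ℝ (⊤ : ℕ∞) u) : ContDiff ℝ (⊤ : ℕ∞) (dX u) :=
  contDiff_dirDeriv hu _

lemma contDiff_dY {u : ℝ × ℝ → ℝ} (hu : ContDiff ℝ (⊤ : ℕ∞) u) : ContDiff ℝ (⊤ : ℕ∞) (dY u) :=
  contDiff_dirDeriv hu _

lemma hasDerivAt_dX {u : ℝ × ℝ → ℝ} (hu : ContDiff ℝ (⊤ : ℕ∞) u) (x y : ℝ) :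
    HasDerivAt (fun s => u (s, y)) (dX u (x, y)) x :=
  hasDerivAt_dirDeriv hu ((hasDerivAt_id x).prodMk (hasDerivAt_const x y))

lemma hasDerivAt_dY {u : ℝ × ℝ → ℝ} (hu : ContDiff ℝ (⊤ : ℕ∞) u) (x y : ℝ) :
    HasDerivAt (fun s => u (x, s)) (dY u (x, y)) y :=
  hasDerivAt_dirDeriv hu ((hasDerivAt_const y x).prodMk (hasDerivAt_id y))

lemma iteratedDeriv_three_slice {u : ℝ × ℝ → ℝ} (hu : ContDiff ℝ (⊤ : ℕ∞) u) (x y : ℝ) :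
    iteratedDeriv 3 (fun s => u (s, y)) x = dX (dX (dX u)) (x, y) := by
  have h1 : deriv (fun s => u (s, y)) = fun s => dX u (s, y) :=
    funext fun s => (hasDerivAt_dX hu s y).deriv
  have h2 : deriv (fun s => dX u (s, y)) = fun s => dX (dX u) (s, y) :=
    funext fun s => (hasDerivAt_dX (contDiff_dX hu) s y).deriv
  rw [iteratedDeriv_succ', h1, iteratedDeriv_succ', h2, iteratedDeriv_one]
  exact (hasDerivAt_dX (contDiff_dX (contDiff_dX hu)) x y).deriv

lemma deriv_iteratedDeriv_two_slice {u : ℝ × ℝ → ℝ} (hu : ContDiff ℝ (⊤ : ℕ∞) u) (x y : ℝ) :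
    deriv (fun s => iteratedDeriv 2 (fun r => u (s, r)) y) x = dX (dY (dY u)) (x, y) := by
  have h : (fun s => iteratedDeriv 2 (fun r => u (s, r)) y) = fun s => dY (dY u) (s, y) := by
    funext s
    have h1 : deriv (fun r => u (s, r)) = fun r => dY u (s, r) :=
      funext fun r => (hasDerivAt_dY hu s r).deriv
    rw [iteratedDeriv_succ', h1, iteratedDeriv_one]
    exact (hasDerivAt_dY (contDiff_dY hu) s y).deriv
  rw [h]
  exact (hasDerivAt_dX (contDiff_dY (contDiff_dY hu)) x y).deriv

/-! ### Integration over the box -/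

/-- Lebesgue measure on the open square `(0,L)×(0,L)`. -/
abbrev boxMeasure (L : ℝ) : Measure (ℝ × ℝ) :=
  (volume.restrict (Ioo 0 L)).prod (volume.restrict (Ioo 0 L))

lemma ae_mem_box (L : ℝ) : ∀ᵐ p ∂(boxMeasure L), p ∈ Ioo (0:ℝ) L ×ˢ Ioo (0:ℝ) L := by
  rw [boxMeasure, Measure.prod_restrict]
  exact ae_restrict_mem (measurableSet_Ioo.prod measurableSet_Ioo)

lemma integrable_Ioo_of_continuous {g : ℝ → ℝ} (hg : Continuous g) (L : ℝ) :
    Integrable g (volume.restrict (Ioo 0 L)) :=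
  (hg.integrableOn_Icc (a := 0) (b := L)).mono_set Ioo_subset_Icc_self

lemma integrable_box_of_continuous {g : ℝ × ℝ → ℝ} (hg : Continuous g) (L : ℝ) :
    Integrable g (boxMeasure L) := by
  rw [boxMeasure, Measure.prod_restrict]
  exact (hg.continuousOn.integrableOn_compact (isCompact_Icc.prod isCompact_Icc)).mono_set
    (prod_mono Ioo_subset_Icc_self Ioo_subset_Icc_self)

lemma intervalIntegral_eq_Ioo {L : ℝ} (hL : 0 ≤ L) (g : ℝ → ℝ) :
    ∫ x in (0:ℝ)..L, g x = ∫ x in Ioo 0 L, g x := by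
  rw [intervalIntegral.integral_of_le hL, integral_Ioc_eq_integral_Ioo]

lemma iterated_eq_box {L : ℝ} (hL : 0 ≤ L) {g : ℝ × ℝ → ℝ} (hg : Integrable g (boxMeasure L)) :
    ∫ x in (0:ℝ)..L, ∫ y in (0:ℝ)..L, g (x, y) = ∫ p, g p ∂(boxMeasure L) := by
  simp_rw [intervalIntegral_eq_Ioo hL]
  exact (integral_prod g hg).symm

lemma sq_integral_mul_le {X : Type*} [MeasurableSpace X] {μ : Measure X} {f g : X → ℝ}
    (hf : Integrable (fun x => f x ^ 2) μ) (hfg : Integrable (fun x => f x * g x) μ)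
    (hg : Integrable (fun x => g x ^ 2) μ) :
    (∫ x, f x * g x ∂μ) ^ 2 ≤ (∫ x, f x ^ 2 ∂μ) * ∫ x, g x ^ 2 ∂μ := by
  have h := discrim_le_zero (a := ∫ x, f x ^ 2 ∂μ) (b := -2 * ∫ x, f x * g x ∂μ)
    (c := ∫ x, g x ^ 2 ∂μ) (fun s => by
      have hs : 0 ≤ ∫ x, (s * f x - g x) ^ 2 ∂μ := integral_nonneg fun x => sq_nonneg _
      have e : ∀ x, (s * f x - g x) ^ 2 = (s * s) * f x ^ 2 + (-2 * s) * (f x * g x) + g x ^ 2 :=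
        fun x => by ring
      simp_rw [e] at hs
      have hi : Integrable (fun x => (s * s) * f x ^ 2 + (-2 * s) * (f x * g x)) μ :=
        (hf.const_mul _).add (hfg.const_mul _)
      rw [integral_add hi hg,
        integral_add (hf.const_mul _) (hfg.const_mul _), MeasureTheory.integral_const_mul,
        MeasureTheory.integral_const_mul] at hs
      linarith)
  rw [discrim] at h
  nlinarith

lemma hasDerivAt_integral_weighted {E : Type*} [TopologicalSpace E] [MeasurableSpace E]
    [OpensMeasurableSpace E] [SecondCountableTopology E]
    {μ : Measure E} [IsFiniteMeasure μ] {K : Set E} (hK : IsCompact K) (hμK : ∀ᵐ p ∂μ, p ∈ K)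
    {w : E → ℝ} (hw : AEStronglyMeasurable w μ) {C : ℝ} (hC : ∀ p, |w p| ≤ C)
    {G G' : E → ℝ → ℝ} (hG : Continuous (Function.uncurry G))
    (hG' : Continuous (Function.uncurry G'))
    (hd : ∀ p t, HasDerivAt (G p) (G' p t) t) (t : ℝ) :
    HasDerivAt (fun t => ∫ p, w p * G p t ∂μ) (∫ p, w p * G' p t ∂μ) t := by
  have hslice : ∀ {H : E → ℝ → ℝ}, Continuous (Function.uncurry H) → ∀ τ,
      Continuous (fun p => H p τ) := fun hH τ =>
    hH.comp (continuous_id.prodMk continuous_const)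
  obtain ⟨M, hM⟩ := (hK.prod (isCompact_Icc (a := t - 1) (b := t + 1))).exists_bound_of_continuousOn
    hG'.continuousOn
  obtain ⟨M₀, hM₀⟩ := hK.exists_bound_of_continuousOn (hslice hG t).continuousOn
  have hint : Integrable (fun p => w p * G p t) μ := by
    refine Integrable.bdd_mul (c := C) ?_ hw (ae_of_all _ hC)
    exact Integrable.of_bound (hslice hG t).aestronglyMeasurable M₀ (hμK.mono fun p hp => hM₀ p hp)
  refine (hasDerivAt_integral_of_dominated_loc_of_deriv_le (bound := fun _ => C * M)
    (Icc_mem_nhds (a := t - 1) (b := t + 1) (by linarith) (by linarith))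
    (.of_forall fun τ => hw.mul (hslice hG τ).aestronglyMeasurable) hint
    (hw.mul (hslice hG' t).aestronglyMeasurable) ?_ (integrable_const _)
    (ae_of_all _ fun p τ _ => (hd p τ).const_mul (w p))).2
  filter_upwards [hμK] with p hp τ hτ
  rw [norm_mul]
  exact mul_le_mul (hC p) (hM (p, τ) ⟨hp, hτ⟩) (norm_nonneg _) ((abs_nonneg _).trans (hC p))

/-! ### Spatial estimates -/

lemma sq_integral_abs_le {v : ℝ → ℝ} (hv : Continuous v) {L : ℝ} (hL : 0 ≤ L) :
    (∫ s in Ioo 0 L, |v s|) ^ 2 ≤ L * ∫ s in Ioo 0 L, v s ^ 2 := by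
  have h := sq_integral_mul_le (μ := volume.restrict (Ioo 0 L)) (f := fun _ => (1:ℝ))
    (g := fun s => |v s|) (integrable_Ioo_of_continuous (by fun_prop) L)
    (integrable_Ioo_of_continuous (by fun_prop) L) (integrable_Ioo_of_continuous (by fun_prop) L)
  simpa [hL] using h

lemma abs_le_integral_abs_deriv {g g' : ℝ → ℝ} (hg : ∀ x, HasDerivAt g (g' x) x)
    (hg' : Continuous g') (h0 : g 0 = 0) {L x : ℝ} (hx : x ∈ Ioo 0 L) :
    |g x| ≤ ∫ s in Ioo 0 L, |g' s| := by
  have h1 : ∫ s in (0:ℝ)..x, g' s = g x := by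
    rw [integral_eq_sub_of_hasDerivAt (fun s _ => hg s) (hg'.intervalIntegrable _ _), h0, sub_zero]
  rw [← h1]
  refine (intervalIntegral.abs_integral_le_integral_abs hx.1.le).trans ?_
  rw [intervalIntegral_eq_Ioo hx.1.le]
  exact setIntegral_mono_set (integrable_Ioo_of_continuous hg'.abs L)
    (ae_of_all _ fun s => abs_nonneg _) (Ioo_subset_Ioo_right hx.2.le).eventuallyLE

lemma continuous_integral_Ioo {X : Type*} [TopologicalSpace X] [FirstCountableTopology X]
    [LocallyCompactSpace X] {f : X → ℝ → ℝ}
    (hf : Continuous (Function.uncurry f)) {L : ℝ} (hL : 0 ≤ L) :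
    Continuous fun x => ∫ s in Ioo 0 L, f x s := by
  simp_rw [← intervalIntegral_eq_Ioo hL]
  exact continuous_parametric_intervalIntegral_of_continuous' hf 0 L

lemma integral_sq_integral_abs_fst_le {v : ℝ × ℝ → ℝ} (hv : Continuous v) {L : ℝ} (hL : 0 ≤ L) :
    ∫ y in Ioo 0 L, (∫ s in Ioo 0 L, |v (s, y)|) ^ 2 ≤ L * ∫ p, v p ^ 2 ∂(boxMeasure L) := by
  rw [boxMeasure, integral_prod_symm _ (integrable_box_of_continuous (g := fun p => v p ^ 2) (hv.pow 2) L),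
    ← MeasureTheory.integral_const_mul]
  refine integral_mono ?_ ?_ fun y => sq_integral_abs_le (by fun_prop) hL
  · exact integrable_Ioo_of_continuous
      ((continuous_integral_Ioo (f := fun y s => |v (s, y)|) (by fun_prop) hL).pow 2) L
  · exact integrable_Ioo_of_continuous (continuous_const.mul
      (continuous_integral_Ioo (f := fun y s => v (s, y) ^ 2) (by fun_prop) hL)) L

lemma integral_sq_integral_abs_snd_le {v : ℝ × ℝ → ℝ} (hv : Continuous v) {L : ℝ} (hL : 0 ≤ L) :
    ∫ x in Ioo 0 L, (∫ s in Ioo 0 L, |v (x, s)|) ^ 2 ≤ L * ∫ p, v p ^ 2 ∂(boxMeasure L) := by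
  rw [boxMeasure, integral_prod _ (integrable_box_of_continuous (g := fun p => v p ^ 2) (hv.pow 2) L),
    ← MeasureTheory.integral_const_mul]
  refine integral_mono ?_ ?_ fun y => sq_integral_abs_le (by fun_prop) hL
  · exact integrable_Ioo_of_continuous
      ((continuous_integral_Ioo (f := fun x s => |v (x, s)|) (by fun_prop) hL).pow 2) L
  · exact integrable_Ioo_of_continuous (continuous_const.mul
      (continuous_integral_Ioo (f := fun x s => v (x, s) ^ 2) (by fun_prop) hL)) L

/-- Spatial boundary conditions for a function on the square. -/
structure BoxBC (L : ℝ) (u : ℝ × ℝ → ℝ) : Prop where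
  left : ∀ y ∈ Ioo (0:ℝ) L, u (0, y) = 0
  right : ∀ y ∈ Ioo (0:ℝ) L, u (L, y) = 0
  dX_right : ∀ y ∈ Ioo (0:ℝ) L, dX u (L, y) = 0
  bottom : ∀ x ∈ Ioo (0:ℝ) L, u (x, 0) = 0
  top : ∀ x ∈ Ioo (0:ℝ) L, u (x, L) = 0

section Spatial

variable {L : ℝ} {u : ℝ × ℝ → ℝ}

lemma BoxBC.abs_le_integral_dX (hu : ContDiff ℝ (⊤ : ℕ∞) u) (hb : BoxBC L u) {p : ℝ × ℝ}
    (hp : p ∈ Ioo (0:ℝ) L ×ˢ Ioo (0:ℝ) L) : |u p| ≤ ∫ s in Ioo 0 L, |dX u (s, p.2)| :=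
  abs_le_integral_abs_deriv (fun s => hasDerivAt_dX hu s p.2)
    ((contDiff_dX hu).continuous.comp (by fun_prop)) (hb.left p.2 hp.2) hp.1

lemma BoxBC.abs_le_integral_dY (hu : ContDiff ℝ (⊤ : ℕ∞) u) (hb : BoxBC L u) {p : ℝ × ℝ}
    (hp : p ∈ Ioo (0:ℝ) L ×ˢ Ioo (0:ℝ) L) : |u p| ≤ ∫ s in Ioo 0 L, |dY u (p.1, s)| :=
  abs_le_integral_abs_deriv (fun s => hasDerivAt_dY hu p.1 s)
    ((contDiff_dY hu).continuous.comp (by fun_prop)) (hb.bottom p.1 hp.1) hp.2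

lemma BoxBC.poincare (hu : ContDiff ℝ (⊤ : ℕ∞) u) (hb : BoxBC L u) (hL : 0 ≤ L) :
    ∫ p, u p ^ 2 ∂(boxMeasure L) ≤ L ^ 2 * ∫ p, dX u p ^ 2 ∂(boxMeasure L) := by
  have hF : Continuous fun y => ∫ s in Ioo 0 L, |dX u (s, y)| :=
    continuous_integral_Ioo (f := fun y s => |dX u (s, y)|)
      ((contDiff_dX hu).continuous.comp (by fun_prop)).abs hL
  have h1 : ∫ p, u p ^ 2 ∂(boxMeasure L) ≤
      ∫ p : ℝ × ℝ, (∫ s in Ioo 0 L, |dX u (s, p.2)|) ^ 2 ∂(boxMeasure L) := by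
    refine integral_mono_ae (integrable_box_of_continuous (hu.continuous.pow 2) L)
      (integrable_box_of_continuous ((hF.comp continuous_snd).pow 2) L) ?_
    filter_upwards [ae_mem_box L] with p hp
    exact sq_le_sq.2 ((hb.abs_le_integral_dX hu hp).trans (le_abs_self _))
  have h2 := integral_prod_mul (μ := volume.restrict (Ioo 0 L)) (ν := volume.restrict (Ioo 0 L))
    (fun _ => (1:ℝ)) (fun y => (∫ s in Ioo 0 L, |dX u (s, y)|) ^ 2)
  simp only [one_mul] at h2
  rw [h2] at h1
  have h3 := integral_sq_integral_abs_fst_le (contDiff_dX hu).continuous hL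
  have h4 : ∫ _x in Ioo 0 L, (1:ℝ) = L := by simp [hL]
  rw [h4] at h1
  nlinarith [mul_le_mul_of_nonneg_left h3 hL]

lemma BoxBC.integral_cube_le (hu : ContDiff ℝ (⊤ : ℕ∞) u) (hb : BoxBC L u) (hL : 0 ≤ L) {r : ℝ}
    (hr : 0 ≤ r) (hN : ∫ p, u p ^ 2 ∂(boxMeasure L) ≤ r ^ 2) :
    ∫ p, u p ^ 3 ∂(boxMeasure L) ≤ L * r / 2 *
      ((∫ p, dX u p ^ 2 ∂(boxMeasure L)) + ∫ p, dY u p ^ 2 ∂(boxMeasure L)) := by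
  set F : ℝ → ℝ := fun y => ∫ s in Ioo 0 L, |dX u (s, y)| with hFdef
  set G : ℝ → ℝ := fun x => ∫ s in Ioo 0 L, |dY u (x, s)| with hGdef
  set A := ∫ p, dX u p ^ 2 ∂(boxMeasure L) with hA
  set B := ∫ p, dY u p ^ 2 ∂(boxMeasure L) with hB
  have hF : Continuous F := continuous_integral_Ioo (f := fun y s => |dX u (s, y)|)
      ((contDiff_dX hu).continuous.comp (by fun_prop)).abs hL
  have hG : Continuous G := continuous_integral_Ioo (f := fun x s => |dY u (x, s)|)
      ((contDiff_dY hu).continuous.comp (by fun_prop)).abs hL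
  have hu' : Continuous u := hu.continuous
  have hA0 : 0 ≤ A := integral_nonneg fun p => sq_nonneg _
  have hB0 : 0 ≤ B := integral_nonneg fun p => sq_nonneg _
  set J := ∫ p : ℝ × ℝ, |u p| * (G p.1 * F p.2) ∂(boxMeasure L) with hJ
  have h1 : ∫ p, u p ^ 3 ∂(boxMeasure L) ≤ J := by
    refine integral_mono_ae (integrable_box_of_continuous (by fun_prop) L)
      (integrable_box_of_continuous (by fun_prop) L) ?_
    filter_upwards [ae_mem_box L] with p hp
    have hx := hb.abs_le_integral_dX hu hp
    have hy := hb.abs_le_integral_dY hu hp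
    calc u p ^ 3 ≤ |u p ^ 3| := le_abs_self _
      _ = |u p| * (|u p| * |u p|) := by rw [abs_pow]; ring
      _ ≤ |u p| * (G p.1 * F p.2) := by
        refine mul_le_mul_of_nonneg_left ?_ (abs_nonneg _)
        exact mul_le_mul hy hx (abs_nonneg _) ((abs_nonneg _).trans hy)
  have h2 : J ^ 2 ≤ r ^ 2 * ((L * B) * (L * A)) := by
    have hcs := sq_integral_mul_le (μ := boxMeasure L) (f := fun p => |u p|)
      (g := fun p => G p.1 * F p.2) (integrable_box_of_continuous (by fun_prop) L)
      (integrable_box_of_continuous (by fun_prop) L) (integrable_box_of_continuous (by fun_prop) L)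
    simp only [sq_abs, mul_pow] at hcs
    rw [integral_prod_mul (fun x => G x ^ 2) (fun y => F y ^ 2)] at hcs
    refine hcs.trans (mul_le_mul hN ?_ ?_ (sq_nonneg _))
    · exact mul_le_mul (integral_sq_integral_abs_snd_le (contDiff_dY hu).continuous hL)
        (integral_sq_integral_abs_fst_le (contDiff_dX hu).continuous hL)
        (integral_nonneg fun _ => sq_nonneg _) (by positivity)
    · exact mul_nonneg (integral_nonneg fun _ => sq_nonneg _) (integral_nonneg fun _ => sq_nonneg _)
  refine h1.trans ((le_abs_self _).trans (abs_le_of_sq_le_sq (h2.trans ?_) (by positivity)))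
  nlinarith [mul_nonneg (sq_nonneg (L * r)) (sq_nonneg (A - B))]

lemma integral_box_dX {P : ℝ × ℝ → ℝ} (hP : ContDiff ℝ (⊤ : ℕ∞) P) (hL : 0 ≤ L) :
    ∫ p, dX P p ∂(boxMeasure L) = ∫ y in Ioo 0 L, (P (L, y) - P (0, y)) := by
  have hc := (contDiff_dX hP).continuous
  rw [boxMeasure, integral_prod_symm _ (integrable_box_of_continuous hc L)]
  congr 1
  funext y
  rw [← intervalIntegral_eq_Ioo hL]
  exact integral_eq_sub_of_hasDerivAt (fun s _ => hasDerivAt_dX hP s y)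
    (Continuous.intervalIntegrable (hc.comp (by fun_prop)) _ _)

lemma integral_box_dY {Q : ℝ × ℝ → ℝ} (hQ : ContDiff ℝ (⊤ : ℕ∞) Q) (hL : 0 ≤ L) :
    ∫ p, dY Q p ∂(boxMeasure L) = ∫ x in Ioo 0 L, (Q (x, L) - Q (x, 0)) := by
  have hc := (contDiff_dY hQ).continuous
  rw [boxMeasure, integral_prod _ (integrable_box_of_continuous hc L)]
  congr 1
  funext x
  rw [← intervalIntegral_eq_Ioo hL]
  exact integral_eq_sub_of_hasDerivAt (fun s _ => hasDerivAt_dY hQ x s)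
    (Continuous.intervalIntegrable (hc.comp (by fun_prop)) _ _)

lemma BoxBC.dY_eq_zero (hu : ContDiff ℝ (⊤ : ℕ∞) u) {c : ℝ} (hc : ∀ y ∈ Ioo (0:ℝ) L, u (c, y) = 0)
    {y : ℝ} (hy : y ∈ Ioo (0:ℝ) L) : dY u (c, y) = 0 := by
  have h : (fun s => u (c, s)) =ᶠ[nhds y] fun _ => 0 :=
    Filter.eventually_of_mem (isOpen_Ioo.mem_nhds hy) hc
  rw [← (hasDerivAt_dY hu c y).deriv, h.deriv_eq, deriv_const]

/-- Energy identity for the spatial part of the equation, tested against `(1 + ε x) u`;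
the boundary contribution at `x = 0` has a favourable sign. -/
lemma BoxBC.le_integral_multiplier (hu : ContDiff ℝ (⊤ : ℕ∞) u) (hb : BoxBC L u) (hL : 0 ≤ L)
    {α γ : ℝ} (hα : 0 ≤ α) (ε : ℝ) :
    ε * (3 * α / 2 * (∫ p, dX u p ^ 2 ∂(boxMeasure L)) + γ / 2 * (∫ p, dY u p ^ 2 ∂(boxMeasure L))
        - 1 / 3 * ∫ p, u p ^ 3 ∂(boxMeasure L)) ≤
      ∫ p, (1 + ε * p.1) * u p *
        (α * dX (dX (dX u)) p + γ * dX (dY (dY u)) p + u p * dX u p) ∂(boxMeasure L) := by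
  have hx := contDiff_dX hu
  have hxx := contDiff_dX hx
  have hy := contDiff_dY hu
  have hxy := contDiff_dX hy
  have hxxx := (contDiff_dX hxx).continuous
  have hxyy := (contDiff_dX (contDiff_dY hy)).continuous
  set P : ℝ × ℝ → ℝ := fun p => α * ((1 + ε * p.1) * u p * dX (dX u) p - ε * (u p * dX u p)
    - (1 + ε * p.1) * dX u p ^ 2 / 2) + (1 + ε * p.1) * u p ^ 3 / 3
    - γ * (1 + ε * p.1) * dY u p ^ 2 / 2 with hPdef
  set Q : ℝ × ℝ → ℝ := fun p => γ * (1 + ε * p.1) * u p * dX (dY u) p with hQdef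
  have hP : ContDiff ℝ (⊤ : ℕ∞) P := by fun_prop
  have hQ : ContDiff ℝ (⊤ : ℕ∞) Q := by fun_prop
  have hPc := (contDiff_dX hP).continuous
  have hQc := (contDiff_dY hQ).continuous
  have hdP : ∀ x y, dX P (x, y) = α * ((1 + ε * x) * u (x, y) * dX (dX (dX u)) (x, y)
      - ε * dX u (x, y) ^ 2 - ε * dX u (x, y) ^ 2 / 2)
      + (ε * u (x, y) ^ 3 / 3 + (1 + ε * x) * u (x, y) ^ 2 * dX u (x, y))
      - γ * (ε * dY u (x, y) ^ 2 / 2 + (1 + ε * x) * dY u (x, y) * dX (dY u) (x, y)) := by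
    intro x y
    have hw : HasDerivAt (fun s : ℝ => 1 + ε * s) ε x := by
      simpa using ((hasDerivAt_id x).const_mul ε).const_add 1
    have d0 := hasDerivAt_dX hu x y
    have d1 := hasDerivAt_dX hx x y
    have d2 := hasDerivAt_dX hxx x y
    have e1 := hasDerivAt_dX hy x y
    have := ((((((hw.mul d0).mul d2).sub ((d0.mul d1).const_mul ε)).sub
      ((hw.mul (d1.pow 2)).div_const 2)).const_mul α).add ((hw.mul (d0.pow 3)).div_const 3)).sub
      (((hw.const_mul γ).mul (e1.pow 2)).div_const 2)
    refine (hasDerivAt_dX hP x y).unique (this.congr_deriv ?_)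
    simp only [Pi.mul_apply, Pi.pow_apply]
    push_cast
    ring
  have hdQ : ∀ x y, dY Q (x, y) = γ * (1 + ε * x) * (dY u (x, y) * dX (dY u) (x, y)
      + u (x, y) * dX (dY (dY u)) (x, y)) := by
    intro x y
    have d0 := hasDerivAt_dY hu x y
    have d1 := hasDerivAt_dY hxy x y
    have hcomm : dY (dX (dY u)) (x, y) = dX (dY (dY u)) (x, y) := dirDeriv_comm hy _ _ _
    rw [hcomm] at d1
    refine (hasDerivAt_dY hQ x y).unique (((d0.const_mul (γ * (1 + ε * x))).mul d1).congr_deriv ?_)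
    ring
  have hPint : 0 ≤ ∫ p, dX P p ∂(boxMeasure L) := by
    rw [integral_box_dX hP hL]
    refine setIntegral_nonneg measurableSet_Ioo fun y hy' => ?_
    simp only [hPdef, hb.left y hy', hb.right y hy', hb.dX_right y hy',
      BoxBC.dY_eq_zero hu hb.left hy', BoxBC.dY_eq_zero hu hb.right hy']
    nlinarith [mul_nonneg hα (sq_nonneg (dX u (0, y)))]
  have hQint : ∫ p, dY Q p ∂(boxMeasure L) = 0 := by
    rw [integral_box_dY hQ hL]
    refine setIntegral_eq_zero_of_forall_eq_zero fun x hx' => ?_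
    simp [hQdef, hb.bottom x hx', hb.top x hx']
  have huc := hu.continuous
  have hxc := hx.continuous
  have hyc := hy.continuous
  have i1 : Integrable (fun p => dX u p ^ 2) (boxMeasure L) :=
    integrable_box_of_continuous (by fun_prop) L
  have i2 : Integrable (fun p => dY u p ^ 2) (boxMeasure L) :=
    integrable_box_of_continuous (by fun_prop) L
  have i3 : Integrable (fun p => u p ^ 3) (boxMeasure L) :=
    integrable_box_of_continuous (by fun_prop) L
  have i4 : Integrable (fun p => dX P p) (boxMeasure L) := integrable_box_of_continuous hPc L
  have i5 : Integrable (fun p => dY Q p) (boxMeasure L) := integrable_box_of_continuous hQc L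
  have hsplit : ∀ p : ℝ × ℝ, (1 + ε * p.1) * u p *
      (α * dX (dX (dX u)) p + γ * dX (dY (dY u)) p + u p * dX u p) =
      dX P p + dY Q p + (ε * (3 * α / 2) * dX u p ^ 2 + ε * (γ / 2) * dY u p ^ 2
        + (- ε / 3) * u p ^ 3) := by
    rintro ⟨x, y⟩
    rw [hdP, hdQ]
    ring
  have j1 : Integrable (fun p => ε * (3 * α / 2) * dX u p ^ 2 + ε * (γ / 2) * dY u p ^ 2)
      (boxMeasure L) := (i1.const_mul _).add (i2.const_mul _)
  have j2 : Integrable (fun p => ε * (3 * α / 2) * dX u p ^ 2 + ε * (γ / 2) * dY u p ^ 2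
        + (- ε / 3) * u p ^ 3) (boxMeasure L) := j1.add (i3.const_mul _)
  have j3 : Integrable (fun p => dX P p + dY Q p) (boxMeasure L) := i4.add i5
  simp_rw [hsplit]
  rw [integral_add j3 j2, integral_add i4 i5, hQint, integral_add j1 (i3.const_mul _),
    integral_add (i1.const_mul _) (i2.const_mul _), MeasureTheory.integral_const_mul,
    MeasureTheory.integral_const_mul, MeasureTheory.integral_const_mul]
  linarith

end Spatial

/-! ### The Lyapunov functional -/

/-- Time derivative of a weighted history integral: the history is transported. -/
lemma hasDerivAt_history {q q' : ℝ → ℝ} (hq : ∀ t, HasDerivAt q (q' t) t) (hq' : Continuous q')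
    {h : ℝ} (hh : h ≠ 0) (ξ ε t : ℝ) :
    HasDerivAt (fun t => ∫ ρ in (0:ℝ)..1, (ξ + ε * (1 - ρ)) * q (t - ρ * h))
      (1 / h * ((ξ + ε) * q t - ξ * q (t - h) - ε * ∫ ρ in (0:ℝ)..1, q (t - ρ * h))) t := by
  have hqc : Continuous q := continuous_iff_continuousAt.2 fun t => (hq t).continuousAt
  have h1 := hasDerivAt_integral_weighted (μ := volume.restrict (Ioo (0:ℝ) 1)) (K := Icc 0 1)
    isCompact_Icc ((ae_restrict_mem measurableSet_Ioo).mono fun _ hp => Ioo_subset_Icc_self hp)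
    (w := fun _ => (1:ℝ)) aestronglyMeasurable_const (C := 1) (by simp)
    (G := fun ρ t => (ξ + ε * (1 - ρ)) * q (t - ρ * h))
    (G' := fun ρ t => (ξ + ε * (1 - ρ)) * q' (t - ρ * h)) (by fun_prop) (by fun_prop)
    (fun ρ t => ((hq (t - ρ * h)).comp_sub_const t (ρ * h)).const_mul _) t
  simp only [one_mul, ← intervalIntegral_eq_Ioo zero_le_one] at h1
  refine h1.congr_deriv ?_
  have hd : ∀ ρ, HasDerivAt (fun ρ => (ξ + ε * (1 - ρ)) * q (t - ρ * h))
      (-ε * q (t - ρ * h) + -h * ((ξ + ε * (1 - ρ)) * q' (t - ρ * h))) ρ := by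
    intro ρ
    have e1 : HasDerivAt (fun ρ : ℝ => ξ + ε * (1 - ρ)) (-ε) ρ := by
      simpa using (((hasDerivAt_id ρ).const_sub 1).const_mul ε).const_add ξ
    have e2 : HasDerivAt (fun ρ : ℝ => t - ρ * h) (-h) ρ := by
      simpa using ((hasDerivAt_id ρ).mul_const h).const_sub t
    refine (e1.mul ((hq (t - ρ * h)).comp ρ e2)).congr_deriv ?_
    simp only [Function.comp_apply]
    ring
  have hftc := integral_eq_sub_of_hasDerivAt (a := 0) (b := 1) (fun ρ _ => hd ρ)
    (Continuous.intervalIntegrable (by fun_prop) _ _)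
  rw [intervalIntegral.integral_add (Continuous.intervalIntegrable (by fun_prop) _ _)
    (Continuous.intervalIntegrable (by fun_prop) _ _), intervalIntegral.integral_const_mul,
    intervalIntegral.integral_const_mul] at hftc
  simp only [sub_self, mul_zero, add_zero, one_mul, zero_mul, sub_zero, mul_one] at hftc
  rw [one_div, eq_inv_mul_iff_mul_eq₀ hh]
  linarith

/-- The energy with spatial weight `1 + ε x` and history weight `ξ + ε (1 - ρ)`. -/
def lyapunov (L h ξ ε : ℝ) (a : ℝ → ℝ → ℝ) (ζ : ℝ → ℝ → ℝ → ℝ) (t : ℝ) : ℝ :=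
  (∫ p : ℝ × ℝ, 1 / 2 * ((1 + ε * p.1) * ζ p.1 p.2 t ^ 2) ∂(boxMeasure L))
  + ∫ p : ℝ × ℝ, a p.1 p.2 *
      (1 / 2 * ∫ ρ in (0:ℝ)..1, (ξ + ε * (1 - ρ)) * ζ p.1 p.2 (t - ρ * h) ^ 2) ∂(boxMeasure L)

section Lyapunov

variable {a : ℝ → ℝ → ℝ} {ζ : ℝ → ℝ → ℝ → ℝ}

lemma Smooth3.hasDerivAt_pT (hζ : Smooth3 ζ) (x y t : ℝ) :
    HasDerivAt (fun τ => ζ x y τ) (pT ζ x y t) t := by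
  have h := hasDerivAt_dirDeriv hζ ((hasDerivAt_const t x).prodMk
    ((hasDerivAt_const t y).prodMk (hasDerivAt_id t)))
  exact h.differentiableAt.hasDerivAt

lemma Smooth3.continuous_pT (hζ : Smooth3 ζ) :
    Continuous fun p : (ℝ × ℝ) × ℝ => pT ζ p.1.1 p.1.2 p.2 := by
  have h : ∀ p : (ℝ × ℝ) × ℝ, pT ζ p.1.1 p.1.2 p.2 =
      dirDeriv ((0, 0, 1) : ℝ × ℝ × ℝ) (fun p => ζ p.1 p.2.1 p.2.2) (p.1.1, p.1.2, p.2) :=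
    fun p => (hasDerivAt_dirDeriv hζ ((hasDerivAt_const p.2 p.1.1).prodMk
      ((hasDerivAt_const p.2 p.1.2).prodMk (hasDerivAt_id p.2)))).deriv
  simp_rw [h]
  exact (contDiff_dirDeriv hζ _).continuous.comp (by fun_prop)

lemma Smooth3.continuous_comp (hζ : Smooth3 ζ) {X : Type*} [TopologicalSpace X] {f g k : X → ℝ}
    (hf : Continuous f) (hg : Continuous g) (hk : Continuous k) :
    Continuous fun p => ζ (f p) (g p) (k p) :=
  (ContDiff.continuous hζ).comp (hf.prodMk (hg.prodMk hk))

lemma Smooth3.slice (hζ : Smooth3 ζ) (t : ℝ) :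
    ContDiff ℝ (⊤ : ℕ∞) fun p : ℝ × ℝ => ζ p.1 p.2 t :=
  ContDiff.comp (g := fun p : ℝ × ℝ × ℝ => ζ p.1 p.2.1 p.2.2)
    (f := fun p : ℝ × ℝ => (p.1, p.2, t)) hζ (by fun_prop)

lemma Smooth3.continuous_history (hζ : Smooth3 ζ) {k : ℝ → ℝ} (hk : Continuous k) (h : ℝ) :
    Continuous fun p : (ℝ × ℝ) × ℝ =>
      ∫ ρ in (0:ℝ)..1, k ρ * ζ p.1.1 p.1.2 (p.2 - ρ * h) ^ 2 := by
  refine continuous_parametric_intervalIntegral_of_continuous'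
    (f := fun (p : (ℝ × ℝ) × ℝ) ρ => k ρ * ζ p.1.1 p.1.2 (p.2 - ρ * h) ^ 2) ?_ 0 1
  exact (hk.comp continuous_snd).mul
    ((hζ.continuous_comp (by fun_prop) (by fun_prop) (by fun_prop)).pow 2)

lemma Coeff.integrable_mul (ha : Coeff a) {g : ℝ × ℝ → ℝ} (hg : Continuous g) (L : ℝ) :
    Integrable (fun p : ℝ × ℝ => a p.1 p.2 * g p) (boxMeasure L) := by
  obtain ⟨hm, h0, M, hM⟩ := ha
  refine (integrable_box_of_continuous hg L).bdd_mul (c := M) hm.aestronglyMeasurable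
    (ae_of_all _ fun p => ?_)
  rw [Real.norm_of_nonneg (h0 _ _)]
  exact hM _ _

lemma hasDerivAt_lyapunov (hζ : Smooth3 ζ) (ha : Coeff a) {h : ℝ} (hh : h ≠ 0) (L ξ ε t : ℝ) :
    HasDerivAt (lyapunov L h ξ ε a ζ)
      ((∫ p : ℝ × ℝ, (1 + ε * p.1) * ζ p.1 p.2 t * pT ζ p.1 p.2 t ∂(boxMeasure L))
      + ∫ p : ℝ × ℝ, a p.1 p.2 * (1 / 2 * (1 / h * ((ξ + ε) * ζ p.1 p.2 t ^ 2
          - ξ * ζ p.1 p.2 (t - h) ^ 2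
          - ε * ∫ ρ in (0:ℝ)..1, ζ p.1 p.2 (t - ρ * h) ^ 2))) ∂(boxMeasure L)) t := by
  have hK : ∀ᵐ p ∂(boxMeasure L), p ∈ Icc (0:ℝ) L ×ˢ Icc (0:ℝ) L :=
    (ae_mem_box L).mono fun p hp => prod_mono Ioo_subset_Icc_self Ioo_subset_Icc_self hp
  have hKc : IsCompact (Icc (0:ℝ) L ×ˢ Icc (0:ℝ) L) := isCompact_Icc.prod isCompact_Icc
  have hz : Continuous fun p : (ℝ × ℝ) × ℝ => ζ p.1.1 p.1.2 p.2 :=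
    hζ.continuous_comp (by fun_prop) (by fun_prop) (by fun_prop)
  have hzh : Continuous fun p : (ℝ × ℝ) × ℝ => ζ p.1.1 p.1.2 (p.2 - h) :=
    hζ.continuous_comp (by fun_prop) (by fun_prop) (by fun_prop)
  have hzt := hζ.continuous_pT
  have hZ := hζ.continuous_history (k := fun _ => 1) continuous_const h
  simp only [one_mul] at hZ
  have hsq : ∀ (p : ℝ × ℝ) t, HasDerivAt (fun τ => ζ p.1 p.2 τ ^ 2)
      (2 * ζ p.1 p.2 t * pT ζ p.1 p.2 t) t := fun p t =>
    ((hζ.hasDerivAt_pT p.1 p.2 t).pow 2).congr_deriv (by simp)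
  have hw : Continuous fun p : (ℝ × ℝ) × ℝ => 1 + ε * p.1.1 := by fun_prop
  have hG₁ : Continuous fun p : (ℝ × ℝ) × ℝ =>
      1 / 2 * ((1 + ε * p.1.1) * ζ p.1.1 p.1.2 p.2 ^ 2) :=
    continuous_const.mul (hw.mul (hz.pow 2))
  have hG₂ : Continuous fun p : (ℝ × ℝ) × ℝ => 1 / 2 * (1 / h * ((ξ + ε) * ζ p.1.1 p.1.2 p.2 ^ 2
      - ξ * ζ p.1.1 p.1.2 (p.2 - h) ^ 2
      - ε * ∫ ρ in (0:ℝ)..1, ζ p.1.1 p.1.2 (p.2 - ρ * h) ^ 2)) :=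
    continuous_const.mul (continuous_const.mul (((continuous_const.mul (hz.pow 2)).sub
      (continuous_const.mul (hzh.pow 2))).sub (continuous_const.mul hZ)))
  have h1 := hasDerivAt_integral_weighted hKc hK (w := fun _ => (1:ℝ)) aestronglyMeasurable_const
    (C := 1) (by simp)
    (G := fun (p : ℝ × ℝ) t => 1 / 2 * ((1 + ε * p.1) * ζ p.1 p.2 t ^ 2))
    (G' := fun (p : ℝ × ℝ) t => (1 + ε * p.1) * ζ p.1 p.2 t * pT ζ p.1 p.2 t)
    hG₁ ((hw.mul hz).mul hzt)
    (fun p t => (((hsq p t).const_mul (1 + ε * p.1)).const_mul (1 / 2)).congr_deriv (by ring)) t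
  obtain ⟨hm, h0, M, hM⟩ := ha
  have h2 := hasDerivAt_integral_weighted hKc hK (w := fun p : ℝ × ℝ => a p.1 p.2)
    hm.aestronglyMeasurable (C := M) (fun p => by rw [abs_of_nonneg (h0 _ _)]; exact hM _ _)
    (G := fun (p : ℝ × ℝ) t =>
      1 / 2 * ∫ ρ in (0:ℝ)..1, (ξ + ε * (1 - ρ)) * ζ p.1 p.2 (t - ρ * h) ^ 2)
    (G' := fun (p : ℝ × ℝ) t => 1 / 2 * (1 / h * ((ξ + ε) * ζ p.1 p.2 t ^ 2
          - ξ * ζ p.1 p.2 (t - h) ^ 2 - ε * ∫ ρ in (0:ℝ)..1, ζ p.1 p.2 (t - ρ * h) ^ 2)))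
    (continuous_const.mul (hζ.continuous_history (by fun_prop) h))
    hG₂
    (fun p t => (hasDerivAt_history (hsq p) (by
      have e1 := hz.comp (Continuous.prodMk_right p)
      have e2 := hzt.comp (Continuous.prodMk_right p)
      exact (continuous_const.mul e1).mul e2) hh ξ ε t).const_mul (1 / 2)) t
  simp only [one_mul] at h1
  exact h1.add h2

variable {L α γ h μ₁ μ₂ ξ ε t : ℝ}

lemma ZKbc.boxBC (hb : ZKbc L ζ) (hζ : Smooth3 ζ) (ht : 0 < t) :
    BoxBC L fun p => ζ p.1 p.2 t where
  left y hy := ((hb t ht).1 y hy).1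
  right y hy := ((hb t ht).1 y hy).2.1
  dX_right y hy := (hasDerivAt_dX (hζ.slice t) L y).deriv.symm.trans ((hb t ht).1 y hy).2.2.1
  bottom x hx := ((hb t ht).2 x hx).1
  top x hx := ((hb t ht).2 x hx).2

lemma damping_nonpos {w a u v c₁ c₂ : ℝ} (ha : 0 ≤ a) (hμ₂ : 0 ≤ μ₂) (hμ : μ₂ ≤ μ₁)
    (hw₁ : 1 ≤ w) (hc₁ : w * μ₂ ≤ c₁) (hc₂ : c₂ ≤ 2 * μ₁ - μ₂) :
    -(w * u * (a * (μ₁ * u + μ₂ * v))) + a * (1 / 2 * (c₂ * u ^ 2 - c₁ * v ^ 2)) ≤ 0 := by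
  have h1 : 0 ≤ (w - 1) * (2 * μ₁ - μ₂) * u ^ 2 := by
    have : 0 ≤ 2 * μ₁ - μ₂ := by linarith
    have : 0 ≤ w - 1 := by linarith
    positivity
  have h2 : 0 ≤ (2 * μ₁ - μ₂ - c₂) * u ^ 2 := mul_nonneg (by linarith) (sq_nonneg _)
  have h3 : 0 ≤ (c₁ - w * μ₂) * v ^ 2 := mul_nonneg (by linarith) (sq_nonneg _)
  have h4 : 0 ≤ w * μ₂ * (u + v) ^ 2 := by positivity
  have h5 : 0 ≤ a * (1 / 2 * ((w - 1) * (2 * μ₁ - μ₂) * u ^ 2 + (2 * μ₁ - μ₂ - c₂) * u ^ 2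
    + (c₁ - w * μ₂) * v ^ 2 + w * μ₂ * (u + v) ^ 2)) := by positivity
  linarith

lemma Smooth3.continuous_delay_energy (hζ : Smooth3 ζ) (h t : ℝ) :
    Continuous fun p : ℝ × ℝ => ∫ ρ in (0:ℝ)..1, ζ p.1 p.2 (t - ρ * h) ^ 2 := by
  have hc := (hζ.continuous_history (k := fun _ => 1) continuous_const h).comp
    (by fun_prop : Continuous fun p : ℝ × ℝ => (p, t))
  simp only [one_mul] at hc
  exact hc

lemma IsMuSol.deriv_lyapunov_le (hsol : IsMuSol L α γ h μ₁ μ₂ a ζ) (ha : Coeff a) (hL : 0 ≤ L)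
    (hα : 0 ≤ α) (hh : 0 < h) (hμ₂ : 0 ≤ μ₂) (hμ : μ₂ ≤ μ₁) (hε : 0 ≤ ε)
    (hε₁ : (1 + ε * L) * μ₂ ≤ ξ / h) (hε₂ : (ξ + ε) / h ≤ 2 * μ₁ - μ₂) (ht : 0 < t) :
    deriv (lyapunov L h ξ ε a ζ) t ≤
      -ε * (3 * α / 2 * (∫ p, dX (fun p => ζ p.1 p.2 t) p ^ 2 ∂(boxMeasure L))
        + γ / 2 * (∫ p, dY (fun p => ζ p.1 p.2 t) p ^ 2 ∂(boxMeasure L))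
        - 1 / 3 * (∫ p : ℝ × ℝ, ζ p.1 p.2 t ^ 3 ∂(boxMeasure L))
        + 1 / (2 * h) * ∫ p : ℝ × ℝ, a p.1 p.2 *
          (∫ ρ in (0:ℝ)..1, ζ p.1 p.2 (t - ρ * h) ^ 2) ∂(boxMeasure L)) := by
  obtain ⟨hζ, hb, hpde⟩ := hsol
  have hu := hζ.slice t
  have hbb := hb.boxBC hζ ht
  rw [(hasDerivAt_lyapunov hζ ha hh.ne' L ξ ε t).deriv]
  have hmain := hbb.le_integral_multiplier hu hL (γ := γ) hα ε
  set u : ℝ × ℝ → ℝ := fun p => ζ p.1 p.2 t with hudef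
  set S : ℝ × ℝ → ℝ := fun p => (1 + ε * p.1) * u p *
    (α * dX (dX (dX u)) p + γ * dX (dY (dY u)) p + u p * dX u p) with hS
  set Z : ℝ × ℝ → ℝ := fun p => ∫ ρ in (0:ℝ)..1, ζ p.1 p.2 (t - ρ * h) ^ 2 with hZdef
  have hsnap : Continuous fun p : ℝ × ℝ => (p, t) := by fun_prop
  have huc : Continuous u := hu.continuous
  have hvc : Continuous fun p : ℝ × ℝ => ζ p.1 p.2 (t - h) := (hζ.slice (t - h)).continuous
  have hutc : Continuous fun p : ℝ × ℝ => pT ζ p.1 p.2 t := hζ.continuous_pT.comp hsnap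
  have hZc : Continuous Z := hζ.continuous_delay_energy h t
  have hSc : Continuous S := by
    have e0 := (contDiff_dX hu).continuous
    have e1 := (contDiff_dX (contDiff_dX (contDiff_dX hu))).continuous
    have e2 := (contDiff_dX (contDiff_dY (contDiff_dY hu))).continuous
    fun_prop
  have i1 : Integrable (fun p : ℝ × ℝ => (1 + ε * p.1) * u p * pT ζ p.1 p.2 t) (boxMeasure L) :=
    integrable_box_of_continuous (by fun_prop) L
  have i2 : Integrable (fun p : ℝ × ℝ => a p.1 p.2 * (1 / 2 * (1 / h * ((ξ + ε) * u p ^ 2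
      - ξ * ζ p.1 p.2 (t - h) ^ 2 - ε * Z p)))) (boxMeasure L) :=
    ha.integrable_mul (by fun_prop) L
  have i3 : Integrable S (boxMeasure L) := integrable_box_of_continuous hSc L
  have i3n : Integrable (fun p => -S p) (boxMeasure L) := i3.neg
  have i4 := ha.integrable_mul hZc L
  have hle : (∫ p : ℝ × ℝ, ((1 + ε * p.1) * u p * pT ζ p.1 p.2 t
      + a p.1 p.2 * (1 / 2 * (1 / h * ((ξ + ε) * u p ^ 2
      - ξ * ζ p.1 p.2 (t - h) ^ 2 - ε * Z p)))) ∂(boxMeasure L)) ≤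
      ∫ p : ℝ × ℝ, (-S p + -(ε / (2 * h)) * (a p.1 p.2 * Z p)) ∂(boxMeasure L) := by
    refine integral_mono_ae (i1.add i2) (i3n.add (i4.const_mul _)) ?_
    filter_upwards [ae_mem_box L] with p hp
    obtain ⟨x, y⟩ := p
    have hx : x ∈ Ioo 0 L := hp.1
    have hpde' := hpde x hx y hp.2 t ht
    have p1 : pX ζ x y t = dX u (x, y) := (hasDerivAt_dX hu x y).deriv
    have p3 : pX3 ζ x y t = dX (dX (dX u)) (x, y) := iteratedDeriv_three_slice hu x y
    have pyy : pXYY ζ x y t = dX (dY (dY u)) (x, y) := deriv_iteratedDeriv_two_slice hu x y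
    rw [p1, p3, pyy] at hpde'
    have hw₁ : 1 ≤ 1 + ε * x := by nlinarith [mul_nonneg hε hx.1.le]
    have hw₂ : (1 + ε * x) * μ₂ ≤ ξ / h := by
      refine le_trans (mul_le_mul_of_nonneg_right ?_ hμ₂) hε₁
      nlinarith [mul_le_mul_of_nonneg_left hx.2.le hε]
    have hdamp := damping_nonpos (u := u (x, y)) (v := ζ x y (t - h)) (ha.2.1 x y) hμ₂ hμ hw₁ hw₂
      hε₂
    have hut : pT ζ x y t = -(α * dX (dX (dX u)) (x, y) + γ * dX (dY (dY u)) (x, y)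
        + u (x, y) * dX u (x, y)) - a x y * (μ₁ * u (x, y) + μ₂ * ζ x y (t - h)) := by
      linarith
    have key : (1 + ε * x) * u (x, y) * pT ζ x y t
        + a x y * (1 / 2 * (1 / h * ((ξ + ε) * u (x, y) ^ 2
          - ξ * ζ x y (t - h) ^ 2 - ε * Z (x, y))))
        = (-S (x, y) + -(ε / (2 * h)) * (a x y * Z (x, y)))
          + (-((1 + ε * x) * u (x, y) * (a x y * (μ₁ * u (x, y) + μ₂ * ζ x y (t - h))))
          + a x y * (1 / 2 * ((ξ + ε) / h * u (x, y) ^ 2 - ξ / h * ζ x y (t - h) ^ 2))) := by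
      rw [hut]
      simp only [hS]
      field_simp
      ring
    change (1 + ε * x) * u (x, y) * pT ζ x y t
        + a x y * (1 / 2 * (1 / h * ((ξ + ε) * u (x, y) ^ 2
          - ξ * ζ x y (t - h) ^ 2 - ε * Z (x, y)))) ≤
      -S (x, y) + -(ε / (2 * h)) * (a x y * Z (x, y))
    linarith
  rw [integral_add i1 i2, integral_add i3n (i4.const_mul _), MeasureTheory.integral_const_mul,
    MeasureTheory.integral_neg] at hle
  refine hle.trans ?_
  have hh2 : ε / (2 * h) = ε * (1 / (2 * h)) := by ring
  rw [hh2]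
  linarith

lemma lyapunov_eq (t : ℝ) :
    lyapunov L h ξ 0 a ζ t = 1 / 2 * (∫ p : ℝ × ℝ, ζ p.1 p.2 t ^ 2 ∂(boxMeasure L))
      + ξ / 2 * ∫ p : ℝ × ℝ, a p.1 p.2 *
        (∫ ρ in (0:ℝ)..1, ζ p.1 p.2 (t - ρ * h) ^ 2) ∂(boxMeasure L) := by
  rw [lyapunov, ← MeasureTheory.integral_const_mul, ← MeasureTheory.integral_const_mul]
  simp only [zero_mul, add_zero, one_mul, intervalIntegral.integral_const_mul]
  congr 2
  funext p
  ring

lemma muE_eq_lyapunov (hζ : Smooth3 ζ) (ha : Coeff a) (hL : 0 ≤ L) (t : ℝ) :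
    muE L h ξ a ζ t = lyapunov L h ξ 0 a ζ t := by
  have h1 := iterated_eq_box hL
    (integrable_box_of_continuous (g := fun p => ζ p.1 p.2 t ^ 2)
      ((hζ.slice t).continuous.pow 2) L)
  have h2 := iterated_eq_box hL (ha.integrable_mul (hζ.continuous_delay_energy h t) L)
  rw [lyapunov_eq, muE]
  simp_rw [intervalIntegral.integral_const_mul]
  rw [h1, h2]

lemma lyapunov_bounds (hζ : Smooth3 ζ) (ha : Coeff a) (hε : 0 ≤ ε) (t : ℝ) :
    lyapunov L h ξ 0 a ζ t ≤ lyapunov L h ξ ε a ζ t ∧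
    lyapunov L h ξ ε a ζ t ≤ (1 + ε * L) / 2 * (∫ p : ℝ × ℝ, ζ p.1 p.2 t ^ 2 ∂(boxMeasure L))
      + (ξ + ε) / 2 * ∫ p : ℝ × ℝ, a p.1 p.2 *
        (∫ ρ in (0:ℝ)..1, ζ p.1 p.2 (t - ρ * h) ^ 2) ∂(boxMeasure L) := by
  have huc : Continuous fun p : ℝ × ℝ => ζ p.1 p.2 t := (hζ.slice t).continuous
  have hsnap : Continuous fun p : ℝ × ℝ => (p, t) := by fun_prop
  have hH : ∀ {k : ℝ → ℝ}, Continuous k → Continuous fun p : ℝ × ℝ =>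
      ∫ ρ in (0:ℝ)..1, k ρ * ζ p.1 p.2 (t - ρ * h) ^ 2 := fun hk =>
    (hζ.continuous_history hk h).comp hsnap
  have hZ := hζ.continuous_delay_energy h t
  have hq : ∀ p : ℝ × ℝ, Continuous fun ρ => ζ p.1 p.2 (t - ρ * h) ^ 2 := fun p =>
    (hζ.continuous_comp (by fun_prop) (by fun_prop) (by fun_prop)).pow 2
  constructor
  · refine add_le_add ?_ ?_
    · refine integral_mono_ae (integrable_box_of_continuous (by fun_prop) L)
        (integrable_box_of_continuous (by fun_prop) L) ?_
      filter_upwards [ae_mem_box L] with p hp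
      have : 0 ≤ ε * p.1 * ζ p.1 p.2 t ^ 2 := mul_nonneg (mul_nonneg hε hp.1.1.le) (sq_nonneg _)
      linarith
    · refine integral_mono (ha.integrable_mul (continuous_const.mul (hH (by fun_prop))) L)
        (ha.integrable_mul (continuous_const.mul (hH (by fun_prop))) L) fun p => ?_
      refine mul_le_mul_of_nonneg_left (mul_le_mul_of_nonneg_left ?_ (by norm_num)) (ha.2.1 _ _)
      refine intervalIntegral.integral_mono_on zero_le_one
        (((by fun_prop : Continuous fun ρ : ℝ => ξ + 0 * (1 - ρ)).mul (hq p)).intervalIntegrable _ _)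
        (((by fun_prop : Continuous fun ρ : ℝ => ξ + ε * (1 - ρ)).mul (hq p)).intervalIntegrable _ _)
        fun ρ hρ => mul_le_mul_of_nonneg_right ?_ (sq_nonneg _)
      have := mul_nonneg hε (sub_nonneg.2 hρ.2)
      linarith
  · rw [← MeasureTheory.integral_const_mul, ← MeasureTheory.integral_const_mul]
    refine add_le_add ?_ ?_
    · refine integral_mono_ae (integrable_box_of_continuous (by fun_prop) L)
        (integrable_box_of_continuous (by fun_prop) L) ?_
      filter_upwards [ae_mem_box L] with p hp
      have : 0 ≤ ε * (L - p.1) * ζ p.1 p.2 t ^ 2 :=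
        mul_nonneg (mul_nonneg hε (sub_nonneg.2 hp.1.2.le)) (sq_nonneg _)
      linarith
    · refine integral_mono (ha.integrable_mul (continuous_const.mul (hH (by fun_prop))) L)
        ((ha.integrable_mul hZ L).const_mul _) fun p => ?_
      have hle : ∫ ρ in (0:ℝ)..1, (ξ + ε * (1 - ρ)) * ζ p.1 p.2 (t - ρ * h) ^ 2 ≤
          (ξ + ε) * ∫ ρ in (0:ℝ)..1, ζ p.1 p.2 (t - ρ * h) ^ 2 := by
        rw [← intervalIntegral.integral_const_mul]
        refine intervalIntegral.integral_mono_on zero_le_one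
          (((by fun_prop : Continuous fun ρ : ℝ => ξ + ε * (1 - ρ)).mul
            (hq p)).intervalIntegrable _ _)
          ((continuous_const.mul (hq p)).intervalIntegrable _ _)
          fun ρ hρ => mul_le_mul_of_nonneg_right ?_ (sq_nonneg _)
        have := mul_nonneg hε hρ.1
        linarith
      have := mul_le_mul_of_nonneg_left hle (ha.2.1 p.1 p.2)
      simp only
      linarith

lemma lyapunov_zero_le_half_Hn2 (hζ : Smooth3 ζ) (ha : Coeff a) (hL : 0 ≤ L) (hξ : 0 ≤ ξ) {Ma : ℝ}
    (hMa : IsEssSupOn L a Ma) :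
    lyapunov L h ξ 0 a ζ 0 ≤
      1 / 2 * Hn2 L (ξ * Ma) (fun x y => ζ x y 0) (fun x y ρ => ζ x y (-(ρ * h))) := by
  have hae : ∀ᵐ p ∂(boxMeasure L), a p.1 p.2 ≤ Ma := by
    have hn : ∀ n : ℕ, ∀ᵐ p ∂(boxMeasure L), a p.1 p.2 ≤ Ma + 1 / ((n : ℝ) + 1) := by
      intro n
      obtain ⟨c, hc, -, hc'⟩ := hMa.exists_between
        (lt_add_of_pos_right Ma (Nat.one_div_pos_of_nat (α := ℝ) (n := n)))
      rw [boxMeasure, Measure.prod_restrict]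
      filter_upwards [hc] with p hp
      exact hp.trans hc'.le
    filter_upwards [ae_all_iff.2 hn] with p hp
    refine ge_of_tendsto' (x := Filter.atTop) ?_ hp
    simpa using (tendsto_one_div_add_atTop_nhds_zero_nat (𝕜 := ℝ)).const_add Ma
  have hZ := hζ.continuous_delay_energy h 0
  have h1 := iterated_eq_box hL
    (integrable_box_of_continuous (g := fun p => ζ p.1 p.2 0 ^ 2)
      ((hζ.slice 0).continuous.pow 2) L)
  have h2 := iterated_eq_box hL (integrable_box_of_continuous hZ L)
  simp only [zero_sub] at h2 hZ
  rw [lyapunov_eq, Hn2, h1, h2]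
  have h3 : ∫ p : ℝ × ℝ, a p.1 p.2 *
        (∫ ρ in (0:ℝ)..1, ζ p.1 p.2 (-(ρ * h)) ^ 2) ∂(boxMeasure L) ≤
      Ma * ∫ p : ℝ × ℝ, (∫ ρ in (0:ℝ)..1, ζ p.1 p.2 (-(ρ * h)) ^ 2) ∂(boxMeasure L) := by
    rw [← MeasureTheory.integral_const_mul]
    refine integral_mono_ae (ha.integrable_mul hZ L)
      ((integrable_box_of_continuous hZ L).const_mul _) ?_
    filter_upwards [hae] with p hp
    exact mul_le_mul_of_nonneg_right hp
      (intervalIntegral.integral_nonneg zero_le_one fun _ _ => sq_nonneg _)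
  have h4 := mul_le_mul_of_nonneg_left h3 hξ
  simp only [zero_sub]
  linarith

end Lyapunov

/-- Exponential decay from a differential inequality on `(0, ∞)`. -/
lemma le_mul_exp_of_deriv_le {V : ℝ → ℝ} (hV : Differentiable ℝ V) {k : ℝ}
    (hd : ∀ t, 0 < t → deriv V t ≤ -k * V t) {t : ℝ} (ht : 0 ≤ t) :
    V t ≤ V 0 * Real.exp (-k * t) := by
  have hW : ∀ s, HasDerivAt (fun s => V s * Real.exp (k * s))
      (deriv V s * Real.exp (k * s) + V s * (Real.exp (k * s) * k)) s := fun s =>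
    (hV s).hasDerivAt.mul (((hasDerivAt_id s).const_mul k).exp.congr_deriv (by simp))
  have hanti : AntitoneOn (fun s => V s * Real.exp (k * s)) (Ici 0) := by
    refine antitoneOn_of_deriv_nonpos (convex_Ici 0)
      (fun s _ => (hW s).continuousAt.continuousWithinAt)
      (fun s _ => (hW s).differentiableAt.differentiableWithinAt) fun s hs => ?_
    rw [interior_Ici] at hs
    rw [(hW s).deriv]
    nlinarith [mul_le_mul_of_nonneg_right (hd s hs) (Real.exp_pos (k * s)).le]
  have h1 := hanti self_mem_Ici (mem_Ici.2 ht) ht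
  simp only [mul_zero, Real.exp_zero, mul_one] at h1
  rw [neg_mul, Real.exp_neg, ← div_eq_mul_inv, le_div_iff₀ (Real.exp_pos _)]
  exact h1

/-- Local stabilization of the μ-system.
There exist `r > 0`, `κ ≥ 1`, `θ > 0` such that every classical solution of the
μ-system with initial state of `H`-norm at most `r` satisfies
`E(t) ≤ κ E(0) e^{-2θ t}` for all `t > 0`. -/
theorem mu_local_stabilization
    (L α γ h μ₁ μ₂ ξ Ma : ℝ) (a : ℝ → ℝ → ℝ)
    (hL : 0 < L) (hα : 0 < α) (hγ : 0 < γ) (hh : 0 < h)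
    (hμ₂ : 0 < μ₂) (hμ : μ₂ < μ₁)
    (ha : Coeff a) (hMa : IsEssSupOn L a Ma)
    (hξ₁ : h * μ₂ < ξ) (hξ₂ : ξ < h * (2*μ₁ - μ₂)) :
    ∃ r > (0:ℝ), ∃ κ : ℝ, 1 ≤ κ ∧ ∃ θ > (0:ℝ),
      ∀ ζ : ℝ → ℝ → ℝ → ℝ, IsMuSol L α γ h μ₁ μ₂ a ζ →
        Real.sqrt (Hn2 L (ξ*Ma) (fun x y => ζ x y 0) (fun x y ρ => ζ x y (-(ρ*h)))) ≤ r →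
        ∀ t > (0:ℝ),
          muE L h ξ a ζ t ≤ κ * muE L h ξ a ζ 0 * Real.exp (-(2*θ)*t) := by
  have hξ : 0 < ξ := (mul_pos hh hμ₂).trans hξ₁
  have hc₁ : 0 < ξ / h - μ₂ := by
    rw [sub_pos, lt_div_iff₀ hh]; linarith
  have hc₂ : 0 < h * (2 * μ₁ - μ₂) - ξ := sub_pos.2 hξ₂
  obtain ⟨ε, hε, hε₁, hε₂⟩ : ∃ ε > (0:ℝ), (1 + ε * L) * μ₂ ≤ ξ / h ∧
      (ξ + ε) / h ≤ 2 * μ₁ - μ₂ := by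
    refine ⟨min ((ξ / h - μ₂) / (L * μ₂)) (h * (2 * μ₁ - μ₂) - ξ), by positivity, ?_, ?_⟩
    · have := (le_div_iff₀ (by positivity)).1
        (min_le_left ((ξ / h - μ₂) / (L * μ₂)) (h * (2 * μ₁ - μ₂) - ξ))
      linarith
    · rw [div_le_iff₀ hh]
      have := min_le_right ((ξ / h - μ₂) / (L * μ₂)) (h * (2 * μ₁ - μ₂) - ξ)
      linarith
  obtain ⟨r, hr, hrα, hrγ⟩ : ∃ r > (0:ℝ), L * r / 2 ≤ 3 / 2 * α ∧ L * r / 2 ≤ 3 / 2 * γ := by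
    have hr : L * (3 * min α γ / L) / 2 = 3 / 2 * min α γ := by field_simp
    refine ⟨3 * min α γ / L, by positivity, ?_, ?_⟩ <;> rw [hr] <;> gcongr
    exacts [min_le_left _ _, min_le_right _ _]
  obtain ⟨k, hk, hk₁, hk₂⟩ : ∃ k > (0:ℝ), k * ((1 + ε * L) / 2) ≤ ε * (α / L ^ 2) ∧
      k * ((ξ + ε) / 2) ≤ ε * (1 / (2 * h)) :=
    ⟨min (ε * (α / L ^ 2) / ((1 + ε * L) / 2)) (ε * (1 / (2 * h)) / ((ξ + ε) / 2)), by positivity,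
      (le_div_iff₀ (by positivity)).1 (min_le_left _ _),
      (le_div_iff₀ (by positivity)).1 (min_le_right _ _)⟩
  refine ⟨r, hr, 1 + ε * L + ε / ξ, by linarith [mul_pos hε hL, div_pos hε hξ], k / 2, half_pos hk,
    fun ζ hsol h0 t ht => ?_⟩
  obtain ⟨hζ, hb, -⟩ := id hsol
  have hdiff : ∀ δ, Differentiable ℝ (lyapunov L h ξ δ a ζ) := fun δ s =>
    (hasDerivAt_lyapunov hζ ha hh.ne' L ξ δ s).differentiableAt
  have hN : ∀ s, 0 ≤ ∫ p : ℝ × ℝ, ζ p.1 p.2 s ^ 2 ∂(boxMeasure L) := fun s =>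
    integral_nonneg fun p => sq_nonneg _
  have hD : ∀ s, 0 ≤ ∫ p : ℝ × ℝ, a p.1 p.2 *
      (∫ ρ in (0:ℝ)..1, ζ p.1 p.2 (s - ρ * h) ^ 2) ∂(boxMeasure L) := fun s =>
    integral_nonneg fun p => mul_nonneg (ha.2.1 _ _)
      (intervalIntegral.integral_nonneg zero_le_one fun _ _ => sq_nonneg _)
  have hsmall : ∀ s, 0 < s → ∫ p : ℝ × ℝ, ζ p.1 p.2 s ^ 2 ∂(boxMeasure L) ≤ r ^ 2 := by
    intro s hs
    have h1 := le_mul_exp_of_deriv_le (hdiff 0) (k := 0) (fun τ hτ => by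
      have := hsol.deriv_lyapunov_le ha hL.le hα.le hh hμ₂.le hμ.le (ξ := ξ) (ε := 0) le_rfl
        (by nlinarith) (by rw [div_le_iff₀ hh]; linarith) hτ
      simpa using this) hs.le
    have h2 := lyapunov_zero_le_half_Hn2 (h := h) hζ ha hL.le hξ.le hMa
    have h3 := (Real.sqrt_le_left hr.le).1 h0
    rw [lyapunov_eq s] at h1
    simp only [neg_zero, zero_mul, Real.exp_zero, mul_one] at h1
    have := mul_nonneg hξ.le (hD s)
    linarith
  have hdecay := le_mul_exp_of_deriv_le (hdiff ε) (k := k) (fun s hs => by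
    have h1 := hsol.deriv_lyapunov_le ha hL.le hα.le hh hμ₂.le hμ.le hε.le hε₁ hε₂ hs
    have hu := hζ.slice s
    have hbb := hb.boxBC hζ hs
    have h2 := hbb.poincare hu hL.le
    have h3 := hbb.integral_cube_le hu hL.le hr.le (hsmall s hs)
    have h4 := (lyapunov_bounds (L := L) (h := h) (ξ := ξ) hζ ha hε.le s).2
    have hA : 0 ≤ ∫ p, dX (fun p => ζ p.1 p.2 s) p ^ 2 ∂(boxMeasure L) :=
      integral_nonneg fun p => sq_nonneg _
    have hB : 0 ≤ ∫ p, dY (fun p => ζ p.1 p.2 s) p ^ 2 ∂(boxMeasure L) :=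
      integral_nonneg fun p => sq_nonneg _
    have hN := hN s
    have hD := hD s
    generalize (∫ p, dX (fun p => ζ p.1 p.2 s) p ^ 2 ∂(boxMeasure L)) = A at *
    generalize (∫ p, dY (fun p => ζ p.1 p.2 s) p ^ 2 ∂(boxMeasure L)) = B at *
    generalize (∫ p : ℝ × ℝ, ζ p.1 p.2 s ^ 2 ∂(boxMeasure L)) = N at *
    generalize (∫ p : ℝ × ℝ, ζ p.1 p.2 s ^ 3 ∂(boxMeasure L)) = C at *
    generalize (∫ p : ℝ × ℝ, a p.1 p.2 *
      (∫ ρ in (0:ℝ)..1, ζ p.1 p.2 (s - ρ * h) ^ 2) ∂(boxMeasure L)) = D at *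
    have hC : 1 / 3 * C ≤ α / 2 * A + γ / 2 * B := by
      linarith [mul_le_mul_of_nonneg_right hrα hA, mul_le_mul_of_nonneg_right hrγ hB]
    have hNA : α / L ^ 2 * N ≤ α * A := by
      have := mul_le_mul_of_nonneg_left h2 (by positivity : 0 ≤ α / L ^ 2)
      rwa [← mul_assoc, div_mul_cancel₀ _ (by positivity)] at this
    have h5 := mul_le_mul_of_nonneg_left h4 hk.le
    have h6 := mul_le_mul_of_nonneg_right hk₁ hN
    have h7 := mul_le_mul_of_nonneg_right hk₂ hD
    have h8 := mul_le_mul_of_nonneg_left (add_le_add hC hNA) hε.le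
    linarith) ht.le
  have hV := (lyapunov_bounds (L := L) (h := h) (ξ := ξ) hζ ha hε.le t).1
  have hV₀ : lyapunov L h ξ ε a ζ 0 ≤ (1 + ε * L + ε / ξ) * lyapunov L h ξ 0 a ζ 0 := by
    refine (lyapunov_bounds (L := L) (h := h) (ξ := ξ) hζ ha hε.le 0).2.trans ?_
    rw [lyapunov_eq 0]
    have hN := hN 0
    have hD := hD 0
    generalize (∫ p : ℝ × ℝ, ζ p.1 p.2 0 ^ 2 ∂(boxMeasure L)) = N at *
    generalize (∫ p : ℝ × ℝ, a p.1 p.2 *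
      (∫ ρ in (0:ℝ)..1, ζ p.1 p.2 (0 - ρ * h) ^ 2) ∂(boxMeasure L)) = D at *
    have h1 : 0 ≤ ε / ξ * N := by positivity
    have h2 : 0 ≤ ε * L * ξ * D := by positivity
    have h3 : ε / ξ * (ξ / 2 * D) = ε / 2 * D := by field_simp
    linarith
  rw [muE_eq_lyapunov hζ ha hL.le, muE_eq_lyapunov hζ ha hL.le, mul_div_cancel₀ k two_ne_zero]
  exact (hV.trans hdecay).trans (mul_le_mul_of_nonneg_right hV₀ (Real.exp_pos _).le)
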